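/- Let T ⊃ T_1 ⊃ U and T ⊃ T'_1 ⊃ U be two chains of minimal inclusions of torsion classes of Λ-modules with T_1 ≠ T'_1. Suppose T ⊃ T_1 is labelled by a brick B, T_1 ⊃ U is labelled by a brick B', T ⊃ T'_1 is labelled by a brick C, and T'_1 ⊃ U is labelled by a brick C'. Then C ≅ B' and C' ≅ B. -/

import Mathlib

/-- A bundled finite-dimensional module over the finite-dimensional `K`-algebra `Λ`
(finite-dimensionality over the base field is equivalent to being finitely
generated over `Λ`). -/
structure FDModule (Λ : Type) [Ring Λ] : Type 1 where
  carrier : Type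
  [isAddCommGroup : AddCommGroup carrier]
  [isModule : Module Λ carrier]
  [isFinite : Module.Finite Λ carrier]

attribute [instance] FDModule.isAddCommGroup FDModule.isModule FDModule.isFinite

/-- `M` is a brick: `M` is non-zero and every non-zero endomorphism of `M` is an
isomorphism. -/
def IsBrick {Λ : Type} [Ring Λ] (M : FDModule Λ) : Prop :=
  Nontrivial M.carrier ∧ ∀ f : M.carrier →ₗ[Λ] M.carrier, f = 0 ∨ Function.Bijective f

/-- `Hom_Λ(M, N) = 0`. -/
def NoHom {Λ : Type} [Ring Λ] (M N : FDModule Λ) : Prop :=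
  ∀ f : M.carrier →ₗ[Λ] N.carrier, f = 0

/-- `0 → L → M → N → 0` is a short exact sequence. -/
def IsShortExact {Λ : Type} [Ring Λ] {L M N : Type} [AddCommGroup L] [Module Λ L]
    [AddCommGroup M] [Module Λ M] [AddCommGroup N] [Module Λ N]
    (f : L →ₗ[Λ] M) (g : M →ₗ[Λ] N) : Prop :=
  Function.Injective f ∧ LinearMap.range f = LinearMap.ker g ∧ Function.Surjective g

/-- The short exact sequence with surjection `g` splits, i.e. `g` admits a
linear section. -/
def SESSplits {Λ : Type} [Ring Λ] {M N : Type} [AddCommGroup M] [Module Λ M]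
    [AddCommGroup N] [Module Λ N] (g : M →ₗ[Λ] N) : Prop :=
  ∃ s : N →ₗ[Λ] M, g.comp s = LinearMap.id

/-- The module `M` lies in `Filt(X)`: it has a finite chain of submodules
`⊥ = c 0 ⊆ c 1 ⊆ … ⊆ c t = ⊤` all of whose subquotients are isomorphic to `X`. -/
def InFilt {Λ : Type} [Ring Λ] (X : FDModule Λ) (M : Type) [AddCommGroup M]
    [Module Λ M] : Prop :=
  ∃ (t : ℕ) (c : Fin (t + 1) → Submodule Λ M),
    Monotone c ∧ c 0 = ⊥ ∧ c (Fin.last t) = ⊤ ∧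
      ∀ k : Fin t,
        Nonempty ((↥(c k.succ) ⧸ Submodule.comap (c k.succ).subtype (c k.castSucc))
          ≃ₗ[Λ] X.carrier)

/-- A torsion class: a class of (finite-dimensional) modules closed under
isomorphisms, containing `0`, and closed under quotient modules and extensions. -/
def IsTorsionClass {Λ : Type} [Ring Λ] (T : Set (FDModule Λ)) : Prop :=
  (∀ M N : FDModule Λ, M ∈ T → Nonempty (M.carrier ≃ₗ[Λ] N.carrier) → N ∈ T) ∧
  (∀ M : FDModule Λ, Subsingleton M.carrier → M ∈ T) ∧
  (∀ M N : FDModule Λ, M ∈ T →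
      (∃ f : M.carrier →ₗ[Λ] N.carrier, Function.Surjective f) → N ∈ T) ∧
  (∀ L M N : FDModule Λ, L ∈ T → N ∈ T →
      ∀ (f : L.carrier →ₗ[Λ] M.carrier) (g : M.carrier →ₗ[Λ] N.carrier),
        IsShortExact f g → M ∈ T)

/-- `U ⊂ T` is a minimal inclusion of torsion classes. -/
def IsMinimalInclusion {Λ : Type} [Ring Λ] (T U : Set (FDModule Λ)) : Prop :=
  IsTorsionClass T ∧ IsTorsionClass U ∧ U ⊂ T ∧
    ∀ V : Set (FDModule Λ), IsTorsionClass V → U ⊆ V → V ⊆ T → V = U ∨ V = T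

/-- `U^⊥`: the class of modules admitting no non-zero homomorphism from any member
of `U`. -/
def PerpSet {Λ : Type} [Ring Λ] (U : Set (FDModule Λ)) : Set (FDModule Λ) :=
  {M | ∀ U' ∈ U, ∀ f : U'.carrier →ₗ[Λ] M.carrier, f = 0}

/-- The class of modules filtered by `B`. -/
def FiltSet {Λ : Type} [Ring Λ] (B : FDModule Λ) : Set (FDModule Λ) :=
  {M | InFilt B M.carrier}

/-- The minimal inclusion `U ⊂ T` is labelled by the brick `B`:
`T ∩ U^⊥ = Filt(B)`. -/
def IsBrickLabel {Λ : Type} [Ring Λ] (T U : Set (FDModule Λ)) (B : FDModule Λ) : Prop :=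
  IsBrick B ∧ T ∩ PerpSet U = FiltSet B

section TorsionClasses

variable {Λ : Type} [Ring Λ]

/-- Every module is filtered by itself. -/
theorem InFilt.self (X : FDModule Λ) : InFilt X X.carrier := by
  refine ⟨1, ![⊥, ⊤], ?_, rfl, rfl, ?_⟩
  · rw [Fin.monotone_iff_le_succ]
    intro i
    fin_cases i
    exact bot_le
  · intro k
    fin_cases k
    exact ⟨(Submodule.quotEquivOfEqBot _ (Submodule.ker_subtype ⊤)).trans Submodule.topEquiv⟩

/-- A non-zero module filtered by `X` surjects onto `X`. -/
theorem InFilt.exists_surjective {X : FDModule Λ} {M : Type} [AddCommGroup M] [Module Λ M]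
    [Nontrivial M] (h : InFilt X M) : ∃ g : M →ₗ[Λ] X.carrier, Function.Surjective g := by
  obtain ⟨t, c, -, h_bot, h_top, h_iso⟩ := h
  cases t with
  | zero => exact absurd (h_bot.symm.trans h_top) bot_ne_top
  | succ n =>
    obtain ⟨e⟩ := h_iso (Fin.last n)
    have hc : c (Fin.last n).succ = ⊤ := h_top
    refine ⟨e.toLinearMap ∘ₗ Submodule.mkQ _ ∘ₗ (LinearEquiv.ofTop _ hc).symm.toLinearMap, ?_⟩
    exact e.surjective.comp
      ((Submodule.mkQ_surjective _).comp (LinearEquiv.ofTop _ hc).symm.surjective)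

theorem IsTorsionClass.mem_of_surjective {T : Set (FDModule Λ)} (hT : IsTorsionClass T)
    {M N : FDModule Λ} (hM : M ∈ T) (f : M.carrier →ₗ[Λ] N.carrier)
    (hf : Function.Surjective f) : N ∈ T :=
  hT.2.2.1 M N hM ⟨f, hf⟩

theorem IsTorsionClass.inter {T T' : Set (FDModule Λ)} (hT : IsTorsionClass T)
    (hT' : IsTorsionClass T') : IsTorsionClass (T ∩ T') :=
  ⟨fun M N h e => ⟨hT.1 M N h.1 e, hT'.1 M N h.2 e⟩,
    fun M h => ⟨hT.2.1 M h, hT'.2.1 M h⟩,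
    fun M N h e => ⟨hT.2.2.1 M N h.1 e, hT'.2.2.1 M N h.2 e⟩,
    fun L M N hL hN f g h =>
      ⟨hT.2.2.2 L M N hL.1 hN.1 f g h, hT'.2.2.2 L M N hL.2 hN.2 f g h⟩⟩

theorem PerpSet.anti {U V : Set (FDModule Λ)} (h : U ⊆ V) : PerpSet V ⊆ PerpSet U :=
  fun _ hM X hX => hM X (h hX)

theorem PerpSet.notMem {U : Set (FDModule Λ)} {M : FDModule Λ} (h : M ∈ PerpSet U)
    [Nontrivial M.carrier] : M ∉ U := by
  intro hM
  obtain ⟨x, hx⟩ := exists_ne (0 : M.carrier)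
  exact hx (LinearMap.congr_fun (h M hM LinearMap.id) x)

theorem IsBrickLabel.mem {T U : Set (FDModule Λ)} {B : FDModule Λ} (h : IsBrickLabel T U B) :
    B ∈ T ∩ PerpSet U :=
  h.2 ▸ InFilt.self B

/-- Two distinct torsion classes covered by the same class and covering the same class `U`
intersect in `U`. -/
theorem IsMinimalInclusion.inter_eq {T T₁ T₁' U : Set (FDModule Λ)}
    (h1 : IsMinimalInclusion T T₁) (h2 : IsMinimalInclusion T₁ U)
    (h3 : IsMinimalInclusion T T₁') (h4 : IsMinimalInclusion T₁' U) (hne : T₁ ≠ T₁') :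
    T₁ ∩ T₁' = U := by
  rcases h2.2.2.2 _ (h2.1.inter h4.1) (Set.subset_inter h2.2.2.1.1 h4.2.2.1.1)
    Set.inter_subset_left with h | h
  · exact h
  · rcases h1.2.2.2 _ h4.1 (Set.inter_eq_left.mp h) h3.2.2.1.1 with h' | h'
    · exact absurd h'.symm hne
    · exact absurd h' h3.2.2.1.ne

variable [IsNoetherianRing Λ]

/-- Every module has a submodule in the torsion class `U` whose quotient lies in `U^⊥`. -/
theorem IsTorsionClass.exists_submodule {U : Set (FDModule Λ)} (hU : IsTorsionClass U)
    (M : FDModule Λ) : ∃ N : Submodule Λ M.carrier,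
      FDModule.mk N ∈ U ∧ FDModule.mk (M.carrier ⧸ N) ∈ PerpSet U := by
  obtain ⟨N, hN, hmax⟩ := set_has_maximal_iff_noetherian.mpr
    (inferInstance : IsNoetherian Λ M.carrier) {N | FDModule.mk N ∈ U}
    ⟨⊥, hU.2.1 _ (inferInstanceAs (Subsingleton (⊥ : Submodule Λ M.carrier)))⟩
  refine ⟨N, hN, fun X hX f => ?_⟩
  have hR : FDModule.mk (LinearMap.range f) ∈ U :=
    hU.mem_of_surjective hX f.rangeRestrict f.surjective_rangeRestrict
  have hle : N ≤ (LinearMap.range f).comap N.mkQ := by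
    simpa using Submodule.comap_mono (f := N.mkQ) (bot_le : ⊥ ≤ LinearMap.range f)
  have hP : FDModule.mk ((LinearMap.range f).comap N.mkQ) ∈ U := by
    refine hU.2.2.2 (FDModule.mk N) _ (FDModule.mk (LinearMap.range f)) hN hR
      (Submodule.inclusion hle) (N.mkQ.restrict fun _ hx => hx)
      ⟨Submodule.inclusion_injective hle, ?_, ?_⟩
    · ext x
      simp [Submodule.range_inclusion, LinearMap.mem_ker, Subtype.ext_iff]
    · rintro ⟨y, hy⟩
      obtain ⟨x, rfl⟩ := N.mkQ_surjective y
      exact ⟨⟨x, hy⟩, rfl⟩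
  have hPN : (LinearMap.range f).comap N.mkQ ≤ N := by
    by_contra h
    exact hmax _ hP (lt_of_le_not_ge hle h)
  rw [← LinearMap.range_eq_bot, eq_bot_iff]
  intro y hy
  obtain ⟨x, rfl⟩ := N.mkQ_surjective y
  exact (Submodule.Quotient.mk_eq_zero N).mpr (hPN hy)

/-- Proper quotients of the brick labelling `T ⊃ U` lie in `U`. -/
theorem IsBrickLabel.mem_of_not_injective {T U : Set (FDModule Λ)} {B Q : FDModule Λ}
    (hT : IsTorsionClass T) (hU : IsTorsionClass U) (h : IsBrickLabel T U B)
    (g : B.carrier →ₗ[Λ] Q.carrier) (hg : Function.Surjective g)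
    (hg' : ¬ Function.Injective g) : Q ∈ U := by
  obtain ⟨N, hN, hNU⟩ := hU.exists_submodule Q
  have hF : FDModule.mk (Q.carrier ⧸ N) ∈ FiltSet B :=
    h.2 ▸ ⟨hT.mem_of_surjective h.mem.1 (N.mkQ ∘ₗ g) (N.mkQ_surjective.comp hg), hNU⟩
  rcases subsingleton_or_nontrivial (Q.carrier ⧸ N) with hs | hs
  · rw [Submodule.Quotient.subsingleton_iff] at hs
    exact hU.1 _ _ hN ⟨LinearEquiv.ofTop N hs⟩
  · obtain ⟨p, hp⟩ := InFilt.exists_surjective hF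
    have hs' : Function.Surjective (p ∘ₗ N.mkQ ∘ₗ g) := hp.comp (N.mkQ_surjective.comp hg)
    rcases h.1.2 (p ∘ₗ N.mkQ ∘ₗ g) with h0 | hb
    · have := h.1.1
      obtain ⟨x, hx⟩ := exists_ne (0 : B.carrier)
      obtain ⟨y, rfl⟩ := hs' x
      exact absurd (LinearMap.congr_fun h0 y) hx
    · exact absurd (Function.Injective.of_comp (f := p ∘ₗ N.mkQ) hb.injective) hg'

/-- In a square `T ⊃ T₁ ⊃ U`, `T ⊃ T₁' ⊃ U`, the labels of the opposite sides `T₁ ⊃ U` and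
`T ⊃ T₁'` are isomorphic. -/
theorem IsBrickLabel.nonempty_linearEquiv {T T₁ T₁' U : Set (FDModule Λ)} {B' C : FDModule Λ}
    (h1 : IsMinimalInclusion T T₁) (h2 : IsMinimalInclusion T₁ U)
    (h3 : IsMinimalInclusion T T₁') (h4 : IsMinimalInclusion T₁' U) (hne : T₁ ≠ T₁')
    (l2 : IsBrickLabel T₁ U B') (l3 : IsBrickLabel T T₁' C) :
    Nonempty (C.carrier ≃ₗ[Λ] B'.carrier) := by
  have := l2.1.1
  have := l3.1.1
  have hperp : B' ∈ PerpSet T₁' := by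
    intro X hX f
    by_contra hf
    have hI : FDModule.mk (LinearMap.range f) ∈ T₁' :=
      h4.1.mem_of_surjective hX f.rangeRestrict f.surjective_rangeRestrict
    have hQ : FDModule.mk (B'.carrier ⧸ LinearMap.range f) ∈ U := by
      refine l2.mem_of_not_injective h2.1 h2.2.1 (LinearMap.range f).mkQ
        (Submodule.mkQ_surjective _) fun hinj => hf ?_
      rwa [← LinearMap.ker_eq_bot, Submodule.ker_mkQ, LinearMap.range_eq_bot] at hinj
    have hB : B' ∈ T₁' := h4.1.2.2.2 _ _ _ hI (h4.2.2.1.1 hQ) (LinearMap.range f).subtype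
      (LinearMap.range f).mkQ
      ⟨Submodule.injective_subtype _, by simp, Submodule.mkQ_surjective _⟩
    exact PerpSet.notMem l2.mem.2 (h1.inter_eq h2 h3 h4 hne ▸ ⟨l2.mem.1, hB⟩)
  have hF : B' ∈ FiltSet C := l3.2 ▸ ⟨h1.2.2.1.1 l2.mem.1, hperp⟩
  obtain ⟨g, hg⟩ := InFilt.exists_surjective hF
  have hinj : Function.Injective g := by
    by_contra hg'
    exact PerpSet.notMem (PerpSet.anti h4.2.2.1.1 l3.mem.2)
      (l2.mem_of_not_injective h2.1 h2.2.1 g hg hg')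
  exact ⟨(LinearEquiv.ofBijective g ⟨hinj, hg⟩).symm⟩

end TorsionClasses

/-- in a square of minimal inclusions of torsion classes
`T ⊃ T₁ ⊃ U` and `T ⊃ T₁' ⊃ U` with `T₁ ≠ T₁'`, labelled by bricks
`B, B'` and `C, C'` respectively, we have `C ≅ B'` and `C' ≅ B`. -/
theorem statement_6 (K : Type) [Field K] (Λ : Type) [Ring Λ] [Algebra K Λ]
    [FiniteDimensional K Λ]
    (T T₁ T₁' U : Set (FDModule Λ)) (B B' C C' : FDModule Λ)
    (h1 : IsMinimalInclusion T T₁) (h2 : IsMinimalInclusion T₁ U)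
    (h3 : IsMinimalInclusion T T₁') (h4 : IsMinimalInclusion T₁' U)
    (hne : T₁ ≠ T₁')
    (l1 : IsBrickLabel T T₁ B) (l2 : IsBrickLabel T₁ U B')
    (l3 : IsBrickLabel T T₁' C) (l4 : IsBrickLabel T₁' U C') :
    Nonempty (C.carrier ≃ₗ[Λ] B'.carrier) ∧ Nonempty (C'.carrier ≃ₗ[Λ] B.carrier) := by
  have : IsNoetherianRing Λ := isNoetherian_of_tower K inferInstance
  exact ⟨IsBrickLabel.nonempty_linearEquiv h1 h2 h3 h4 hne l2 l3,
    (IsBrickLabel.nonempty_linearEquiv h3 h4 h1 h2 hne.symm l4 l1).map LinearEquiv.symm⟩
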